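/- arXiv:2410.02614 — 2 statements merged into one kernel-verified Lean document; each statement's English description precedes it below -/
import Mathlib

section
/- Let X be a countable set, G a group acting on X, and ν : X → (0, ∞) a summable function such that for every g ∈ G, ν(gx)/ν(x) → 1 as x escapes finite subsets of X. Then for every finite symmetric subset S ⊆ G containing the identity and every x ∈ X, limsup_{n→∞} |Sⁿx|^{1/n} = 1. -/
open Filter

/-- The set of points reachable from `x` by products of at most `n` elements of `S`. -/
def orbitSet {G X : Type*} [Group G] [MulAction G X] (S : Finset G) (x : X) (n : ℕ) : Set X :=
  {y | ∃ l : List G, l.length ≤ n ∧ (∀ g ∈ l, g ∈ S) ∧ l.prod • x = y}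

theorem moderate_lower_bound
    {G X : Type*} [Group G] [MulAction G X]
    (ν : X → ℝ) (hpos : ∀ x, 0 < ν x)
    (hmod : ∀ g : G, Tendsto (fun x : X => ν (g • x) / ν x) cofinite (nhds 1))
    (S : Finset G) (x : X) (c : ℝ) (hc0 : 0 < c) (hc1 : c < 1) :
    ∃ m : ℝ, 0 < m ∧ ∀ n : ℕ, ∀ y ∈ orbitSet S x n, m * c ^ n ≤ ν y := by
  have hF : ∀ s : G, {z : X | ¬ c < ν (s • z) / ν z}.Finite := fun s =>
    (hmod s).eventually (lt_mem_nhds hc1)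
  let A : Set X := insert x (⋃ s ∈ S, (fun z => s • z) '' {z : X | ¬ c < ν (s • z) / ν z})
  have hA : A.Finite :=
    (S.finite_toSet.biUnion (fun s _ => (hF s).image _)).insert x
  obtain ⟨a, -, ha⟩ := Set.exists_min_image A ν hA ⟨x, Set.mem_insert _ _⟩
  refine ⟨ν a, hpos a, ?_⟩
  have key : ∀ l : List G, (∀ g ∈ l, g ∈ S) → ν a * c ^ l.length ≤ ν (l.prod • x) := by
    intro l
    induction l with
    | nil => intro _; simpa using ha x (Set.mem_insert _ _)
    | cons s t ih =>
      intro h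
      have ht := ih (fun g hg => h g (List.mem_cons_of_mem _ hg))
      have hs : s ∈ S := h s List.mem_cons_self
      rw [List.prod_cons, mul_smul, List.length_cons]
      by_cases hz : c < ν (s • (t.prod • x)) / ν (t.prod • x)
      · rw [lt_div_iff₀ (hpos _)] at hz
        calc ν a * c ^ (t.length + 1) = c * (ν a * c ^ t.length) := by ring
          _ ≤ c * ν (t.prod • x) := by gcongr
          _ ≤ _ := hz.le
      · have h1 : ν a ≤ ν (s • (t.prod • x)) := by
          apply ha
          refine Set.mem_insert_of_mem _ (Set.mem_biUnion hs ⟨t.prod • x, hz, rfl⟩)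
        exact (mul_le_of_le_one_right (hpos a).le (pow_le_one₀ hc0.le hc1.le)).trans h1
  rintro n y ⟨l, hl, hS, rfl⟩
  refine le_trans ?_ (key l hS)
  exact mul_le_mul_of_nonneg_left (pow_le_pow_of_le_one hc0.le hc1.le hl) (hpos a).le

theorem limsup_orbit_growth_one_of_moderate
    {G X : Type*} [Group G] [MulAction G X] [Countable X]
    (ν : X → ℝ) (hsum : Summable ν) (hpos : ∀ x, 0 < ν x)
    (hmod : ∀ g : G, Tendsto (fun x : X => ν (g • x) / ν x) cofinite (nhds 1))
    (S : Finset G) (hsymm : ∀ s ∈ S, s⁻¹ ∈ S) (hone : (1 : G) ∈ S) (x : X) :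
    limsup (fun n : ℕ => (Nat.card (orbitSet S x n) : ℝ) ^ (1 / (n : ℝ))) atTop = 1 := by
  apply Tendsto.limsup_eq
  have lower : ∀ n : ℕ, (orbitSet S x n).Finite → (1 : ℝ) ≤ Nat.card (orbitSet S x n) := by
    intro n hfin
    have := hfin.to_subtype
    have : Nonempty (orbitSet S x n) := ⟨⟨x, [], by simp, by simp, by simp⟩⟩
    exact_mod_cast Nat.card_pos (α := orbitSet S x n)
  have main : ∀ c : ℝ, 0 < c → c < 1 → ∃ K : ℝ, 0 < K ∧ ∀ n : ℕ,
      (orbitSet S x n).Finite ∧ (Nat.card (orbitSet S x n) : ℝ) ≤ K * c⁻¹ ^ n := by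
    intro c hc0 hc1
    obtain ⟨m, hm, hb⟩ := moderate_lower_bound ν hpos hmod S x c hc0 hc1
    refine ⟨(∑' y, ν y) / m, div_pos (hsum.tsum_pos (fun y => (hpos y).le) x (hpos x)) hm, ?_⟩
    intro n
    have hd : 0 < m * c ^ n := by positivity
    have hfin : (orbitSet S x n).Finite := by
      have h := hsum.tendsto_cofinite_zero.eventually (gt_mem_nhds hd)
      refine Set.Finite.subset h ?_
      intro y hy
      exact not_lt.mpr (hb n y hy)
    refine ⟨hfin, ?_⟩
    have h1 : ∑ y ∈ hfin.toFinset, ν y ≤ ∑' y, ν y :=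
      hsum.sum_le_tsum _ (fun y _ => (hpos y).le)
    have h2 : hfin.toFinset.card • (m * c ^ n) ≤ ∑ y ∈ hfin.toFinset, ν y :=
      Finset.card_nsmul_le_sum _ _ _ (fun y hy => hb n y (by simpa using hy))
    have h3 : Nat.card (orbitSet S x n) = hfin.toFinset.card := Nat.card_eq_card_finite_toFinset hfin
    rw [h3]
    rw [nsmul_eq_mul] at h2
    have h4 := (le_div_iff₀ hd).mpr (h2.trans h1)
    refine h4.trans (le_of_eq ?_)
    rw [inv_pow]
    field_simp
  rw [tendsto_order]
  constructor
  · intro a ha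
    refine Eventually.of_forall fun n => ha.trans_le ?_
    obtain ⟨K, -, h⟩ := main (1 / 2) (by norm_num) (by norm_num)
    exact Real.one_le_rpow (lower n (h n).1) (by positivity)
  · intro a ha
    obtain ⟨b, hb1, hba⟩ := exists_between ha
    have hb0 : 0 < b := by linarith
    obtain ⟨K, hK, h⟩ := main b⁻¹ (by positivity) (inv_lt_one_of_one_lt₀ hb1)
    have hlim : Tendsto (fun n : ℕ => K ^ (1 / (n : ℝ)) * b) atTop (nhds (1 * b)) := by
      refine Tendsto.mul_const b ?_
      have := ((Real.continuous_const_rpow hK.ne').tendsto 0).comp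
        (tendsto_one_div_atTop_nhds_zero_nat (𝕜 := ℝ))
      rw [Real.rpow_zero] at this
      exact this
    rw [one_mul] at hlim
    filter_upwards [hlim.eventually (gt_mem_nhds hba), eventually_gt_atTop 0] with n hn hn0
    refine lt_of_le_of_lt ?_ hn
    have h5 := (h n).2
    rw [inv_inv] at h5
    calc _ ≤ (K * b ^ n) ^ (1 / (n : ℝ)) :=
          Real.rpow_le_rpow (by positivity) h5 (by positivity)
      _ = K ^ (1 / (n : ℝ)) * b := by
          rw [Real.mul_rpow hK.le (by positivity), one_div, Real.pow_rpow_inv_natCast hb0.le hn0.ne']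
end

section
/- Let G be a countable group acting on a countable set X. Then X admits a moderate ℓ¹-function if and only if X has subexponential growth of orbits. -/
open Filter

theorem orbitSet_finite {G X : Type*} [Group G] [MulAction G X] (S : Finset G) (x : X) (n : ℕ) :
    (orbitSet S x n).Finite := by
  induction n with
  | zero =>
    refine (Set.finite_singleton x).subset ?_
    rintro y ⟨l, hl, -, rfl⟩
    have : l = [] := List.length_eq_zero_iff.1 (by omega)
    simp [this]
  | succ n ih =>
    refine ((Set.finite_singleton x).union
      (Set.Finite.image2 (fun (g : G) (y : X) => g • y) S.finite_toSet ih)).subset ?_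
    rintro y ⟨l, hl, hS, rfl⟩
    cases l with
    | nil => left; simp
    | cons g l =>
      right
      refine ⟨g, by simpa using hS g (by simp), l.prod • x, ⟨l, by simpa using hl, fun h hh => hS h (by simp [hh]), rfl⟩, ?_⟩
      simp [mul_smul]

theorem self_mem_orbitSet {G X : Type*} [Group G] [MulAction G X] (S : Finset G) (x : X) (n : ℕ) :
    x ∈ orbitSet S x n := ⟨[], by simp, by simp, by simp⟩

theorem smul_mem_orbitSet {G X : Type*} [Group G] [MulAction G X] {S : Finset G} {x y : X} {n : ℕ}
    {g : G} (hg : g ∈ S) (hy : y ∈ orbitSet S x n) : g • y ∈ orbitSet S x (n + 1) := by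
  obtain ⟨l, hl, hS, rfl⟩ := hy
  refine ⟨g :: l, by simpa using hl, ?_, by simp [mul_smul]⟩
  intro h hh
  rcases List.mem_cons.1 hh with rfl | hh
  · exact hg
  · exact hS h hh

theorem orbitSet_mono {G X : Type*} [Group G] [MulAction G X] {S T : Finset G} {x : X} {m n : ℕ}
    (hST : S ⊆ T) (hmn : m ≤ n) : orbitSet S x m ⊆ orbitSet T x n := by
  rintro y ⟨l, hl, hS, rfl⟩
  exact ⟨l, hl.trans hmn, fun g hg => hST (hS g hg), rfl⟩

theorem forward_dir {G X : Type*} [Group G] [MulAction G X] (ν : X → ℝ) (hs : Summable ν)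
    (hpos : ∀ x, 0 < ν x)
    (hν : ∀ g : G, Tendsto (fun x : X => ν (g • x) / ν x) cofinite (nhds 1))
    (S : Finset G) (x : X) :
    Tendsto (fun n : ℕ => (Nat.card (orbitSet S x n) : ℝ) ^ (1 / (n : ℝ))) atTop (nhds 1) := by
  have hcard : ∀ n, (1 : ℝ) ≤ Nat.card (orbitSet S x n) := by
    intro n
    have : Finite (orbitSet S x n) := orbitSet_finite S x n
    have : Nonempty (orbitSet S x n) := ⟨⟨x, self_mem_orbitSet S x n⟩⟩
    exact_mod_cast Nat.card_pos
  -- main bound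
  have key : ∀ ρ : ℝ, 1 < ρ → ∃ C : ℝ, 0 < C ∧ ∀ n, (Nat.card (orbitSet S x n) : ℝ) ≤ C * ρ ^ n := by
    intro ρ hρ
    have hρ0 : 0 < ρ := by linarith
    have hρi : ρ⁻¹ < 1 := inv_lt_one_of_one_lt₀ hρ
    have hev : ∀ᶠ y : X in cofinite, ∀ g ∈ S, ρ⁻¹ * ν y ≤ ν (g • y) := by
      rw [Filter.eventually_all_finset]
      intro g _
      filter_upwards [(hν g).eventually (lt_mem_nhds hρi)] with y hy
      exact ((lt_div_iff₀ (hpos y)).1 hy).le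
    have hF : {y : X | ¬ ∀ g ∈ S, ρ⁻¹ * ν y ≤ ν (g • y)}.Finite := hev
    set F := {y : X | ¬ ∀ g ∈ S, ρ⁻¹ * ν y ≤ ν (g • y)} with hFdef
    have hE : (insert x (Set.image2 (fun (g : G) (y : X) => g • y) (S : Set G) F)).Finite :=
      (Set.Finite.image2 _ S.finite_toSet hF).insert x
    obtain ⟨z, hz, hzmin⟩ := Set.exists_min_image _ ν hE ⟨x, Set.mem_insert _ _⟩
    have hlow : ∀ n, ∀ y ∈ orbitSet S x n, ν z * ρ⁻¹ ^ n ≤ ν y := by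
      have hle : ∀ n, ν z * ρ⁻¹ ^ n ≤ ν z := fun n =>
        mul_le_of_le_one_right (hpos z).le (pow_le_one₀ (by positivity) hρi.le)
      intro n
      induction n with
      | zero =>
        rintro y ⟨l, hl, -, rfl⟩
        have : l = [] := List.length_eq_zero_iff.1 (by omega)
        subst this
        simpa using hzmin x (Set.mem_insert _ _)
      | succ n ih =>
        rintro y ⟨l, hl, hS, rfl⟩
        cases l with
        | nil =>
          refine (hle _).trans ?_
          simpa using hzmin x (Set.mem_insert _ _)
        | cons g l =>
          have hgS : g ∈ S := hS g (by simp)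
          have hmem : l.prod • x ∈ orbitSet S x n :=
            ⟨l, by simpa using hl, fun h hh => hS h (by simp [hh]), rfl⟩
          have e : (g :: l).prod • x = g • (l.prod • x) := by simp [mul_smul]
          rw [e]
          by_cases hyF : l.prod • x ∈ F
          · exact (hle _).trans (hzmin _ (Set.mem_insert_of_mem _ ⟨g, hgS, _, hyF, rfl⟩))
          · have h1 : ρ⁻¹ * ν (l.prod • x) ≤ ν (g • (l.prod • x)) := by
              have : ∀ g ∈ S, ρ⁻¹ * ν (l.prod • x) ≤ ν (g • (l.prod • x)) := by
                by_contra hcon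
                exact hyF hcon
              exact this g hgS
            refine le_trans ?_ h1
            rw [pow_succ]
            have := mul_le_mul_of_nonneg_left (ih _ hmem) (inv_nonneg.2 hρ0.le)
            linarith
    refine ⟨(∑' y, ν y) / ν z, ?_, ?_⟩
    · have := hs.tsum_pos (fun y => (hpos y).le) x (hpos x)
      exact div_pos this (hpos z)
    · intro n
      have h1 : ∑ y ∈ (orbitSet_finite S x n).toFinset, ν y ≤ ∑' y, ν y :=
        hs.sum_le_tsum _ (fun y _ => (hpos y).le)
      have h2 : (orbitSet_finite S x n).toFinset.card • (ν z * ρ⁻¹ ^ n) ≤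
          ∑ y ∈ (orbitSet_finite S x n).toFinset, ν y :=
        Finset.card_nsmul_le_sum _ _ _ (fun y hy => hlow n y (by simpa using hy))
      have h3 : (orbitSet_finite S x n).toFinset.card = Nat.card (orbitSet S x n) := by
        rw [Nat.card_coe_set_eq, Set.ncard_eq_toFinset_card _ (orbitSet_finite S x n)]
      rw [h3, nsmul_eq_mul] at h2
      have h4 := h2.trans h1
      rw [div_mul_eq_mul_div, le_div_iff₀ (hpos z)]
      have h5 := mul_le_mul_of_nonneg_right h4 (pow_pos hρ0 n).le
      have h6 : ρ⁻¹ ^ n * ρ ^ n = 1 := by rw [← mul_pow, inv_mul_cancel₀ hρ0.ne', one_pow]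
      calc _ = (Nat.card (orbitSet S x n) : ℝ) * (ν z * ρ⁻¹ ^ n) * ρ ^ n := by
            rw [mul_assoc, mul_assoc, h6, mul_one]
        _ ≤ _ := h5
  rw [tendsto_order]
  constructor
  · intro a ha
    refine Eventually.of_forall fun n => lt_of_lt_of_le ha ?_
    exact Real.one_le_rpow (hcard n) (by positivity)
  · intro b hb
    obtain ⟨ρ, hρ, hρb⟩ := exists_between hb
    obtain ⟨C, hC, hCn⟩ := key ρ hρ
    have hρ0 : 0 < ρ := by linarith
    have ht : Tendsto (fun n : ℕ => C ^ (1 / (n : ℝ)) * ρ) atTop (nhds ρ) := by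
      have h0 : Tendsto (fun n : ℕ => 1 / (n : ℝ)) atTop (nhds 0) := tendsto_one_div_atTop_nhds_zero_nat
      have h1 := ((Real.continuousAt_const_rpow hC.ne').tendsto.comp h0).mul_const ρ
      simpa using h1
    filter_upwards [ht.eventually (gt_mem_nhds hρb), eventually_gt_atTop 0] with n hn hn0
    refine lt_of_le_of_lt ?_ hn
    calc (Nat.card (orbitSet S x n) : ℝ) ^ (1 / (n : ℝ)) ≤ (C * ρ ^ n) ^ (1 / (n : ℝ)) :=
          Real.rpow_le_rpow (by positivity) (hCn n) (by positivity)
      _ = C ^ (1 / (n : ℝ)) * ρ := by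
          rw [Real.mul_rpow hC.le (by positivity), one_div, Real.pow_rpow_inv_natCast hρ0.le hn0.ne']

theorem abstract_back {G X : Type*} [Group G] [MulAction G X] (v : ℕ → X → ℝ) (r : ℕ → ℝ)
    (hv0 : ∀ k y, 0 ≤ v k y) (hvs : ∀ k, Summable (v k)) (hvpos : ∀ y, ∃ k, 0 < v k y)
    (hr : Tendsto r atTop (nhds 1))
    (hg : ∀ g : G, ∀ᶠ k in atTop, ∀ y, r k * v k y ≤ v k (g • y))
    (ho : ∀ k, ∀ δ : ℝ, 0 < δ → ∀ᶠ y in cofinite, v k y ≤ δ * v (k + 1) y) :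
    ∃ ν : X → ℝ, Summable ν ∧ (∀ x, 0 < ν x) ∧
        ∀ g : G, Tendsto (fun x : X => ν (g • x) / ν x) cofinite (nhds 1) := by
  -- normalisation
  obtain ⟨w, hw0, hws⟩ : ∃ w : ℕ → ℝ, (∀ k, 0 < w k) ∧ Summable (fun k => w k * ∑' y, v k y) := by
    have hT : ∀ k, 0 ≤ ∑' y, v k y := fun k => tsum_nonneg (hv0 k)
    refine ⟨fun k => (1 / 2) ^ k / (1 + ∑' y, v k y), fun k => ?_, ?_⟩
    · have := hT k
      positivity
    · refine Summable.of_nonneg_of_le (fun k => ?_) (fun k => ?_) summable_geometric_two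
      · have := hT k
        positivity
      · have := hT k
        rw [div_mul_eq_mul_div, div_le_iff₀ (by positivity)]
        have : (0 : ℝ) < (1 / 2) ^ k := by positivity
        nlinarith
  set f : ℕ → X → ℝ := fun k y => w k * v k y with hf
  have hf0 : ∀ k y, 0 ≤ f k y := fun k y => mul_nonneg (hw0 k).le (hv0 k y)
  have hprod : Summable (fun p : ℕ × X => f p.1 p.2) := by
    rw [summable_prod_of_nonneg (fun p => hf0 p.1 p.2)]
    refine ⟨fun k => (hvs k).mul_left (w k), ?_⟩
    refine hws.congr fun k => ?_
    exact tsum_mul_left.symm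
  have hswap : Summable (fun p : X × ℕ => f p.2 p.1) := hprod.prod_symm
  have hfs : ∀ y, Summable (fun k => f k y) := fun y => hswap.prod_factor y
  have hνs : Summable (fun y => ∑' k, f k y) := hswap.prod
  have hνpos : ∀ y, 0 < ∑' k, f k y := by
    intro y
    obtain ⟨k, hk⟩ := hvpos y
    exact (hfs y).tsum_pos (fun k => hf0 k y) k (mul_pos (hw0 k) hk)
  have hfo : ∀ k, ∀ δ : ℝ, 0 < δ → ∀ᶠ y in cofinite, f k y ≤ δ * f (k + 1) y := by
    intro k δ hδ
    have h1 := hw0 k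
    have h2 := hw0 (k + 1)
    filter_upwards [ho k (δ * w (k + 1) / w k) (by positivity)] with y hy
    have := mul_le_mul_of_nonneg_left hy h1.le
    calc f k y ≤ _ := this
      _ = _ := by simp only [hf]; field_simp
  have hsum : ∀ m, ∀ δ : ℝ, 0 < δ → ∀ᶠ y in cofinite, ∑ k ∈ Finset.range m, f k y ≤ δ * f m y := by
    intro m
    induction m with
    | zero =>
      intro δ hδ
      refine Eventually.of_forall fun y => ?_
      simpa using mul_nonneg hδ.le (hf0 0 y)
    | succ m ih =>
      intro δ hδ
      filter_upwards [ih 1 one_pos, hfo m (δ / 2) (by positivity)] with y h1 h2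
      rw [Finset.sum_range_succ]
      linarith
  have hlow : ∀ g : G, ∀ c : ℝ, 0 < c → c < 1 →
      ∀ᶠ y in cofinite, c * (∑' k, f k y) ≤ ∑' k, f k (g • y) := by
    intro g c hc0 hc
    obtain ⟨d, hcd, hd⟩ := exists_between hc
    obtain ⟨K, hK⟩ := eventually_atTop.1 ((hg g).and (hr.eventually (lt_mem_nhds hd)))
    have hδ : 0 < d / c - 1 := by
      rw [sub_pos, one_lt_div hc0]; exact hcd
    filter_upwards [hsum K _ hδ] with y hy
    have hs1 : Summable (fun k => f (k + K) y) := (summable_nat_add_iff K).2 (hfs y)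
    have hs2 : Summable (fun k => f (k + K) (g • y)) := (summable_nat_add_iff K).2 (hfs (g • y))
    have e1 := (hfs y).sum_add_tsum_nat_add K
    have e2 := (hfs (g • y)).sum_add_tsum_nat_add K
    have h1 : 0 ≤ ∑ k ∈ Finset.range K, f k (g • y) := Finset.sum_nonneg fun k _ => hf0 k _
    have h2 : d * ∑' k, f (k + K) y ≤ ∑' k, f (k + K) (g • y) := by
      rw [← tsum_mul_left]
      refine (hs1.mul_left d).tsum_le_tsum (fun k => ?_) hs2
      obtain ⟨ha, hb⟩ := hK (k + K) (by omega)
      have h3 : d * v (k + K) y ≤ v (k + K) (g • y) :=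
        (mul_le_mul_of_nonneg_right hb.le (hv0 _ _)).trans (ha y)
      have := mul_le_mul_of_nonneg_left h3 (hw0 (k + K)).le
      simp only [hf]
      linarith
    have h3 : f K y ≤ ∑' k, f (k + K) y := by
      simpa using hs1.le_tsum 0 (fun k _ => hf0 _ _)
    have h4 : ∑' k, f k y ≤ (d / c) * ∑' k, f (k + K) y := by
      have := mul_le_mul_of_nonneg_left h3 hδ.le
      linarith
    have h5 := mul_le_mul_of_nonneg_left h4 hc0.le
    rw [← mul_assoc, mul_div_cancel₀ _ hc0.ne'] at h5
    linarith
  refine ⟨fun y => ∑' k, f k y, hνs, hνpos, fun g => ?_⟩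
  rw [tendsto_order]
  constructor
  · intro a ha
    obtain ⟨c, hac, hc⟩ := exists_between (max_lt ha one_half_lt_one)
    have hc0 : 0 < c := lt_trans (by norm_num) ((le_max_right _ _).trans_lt hac)
    filter_upwards [hlow g c hc0 hc] with y hy
    refine ((le_max_left _ _).trans_lt hac).trans_le ?_
    rwa [le_div_iff₀ (hνpos y)]
  · intro b hb
    obtain ⟨ρ, hρ, hρb⟩ := exists_between hb
    have hρ0 : 0 < ρ := by linarith
    have hev := hlow g⁻¹ ρ⁻¹ (by positivity) (inv_lt_one_of_one_lt₀ hρ)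
    have hev2 := (MulAction.injective g : Function.Injective (fun y : X => g • y)).tendsto_cofinite.eventually hev
    filter_upwards [hev2] with y hy
    refine lt_of_le_of_lt ?_ hρb
    simp only [inv_smul_smul] at hy
    rw [div_le_iff₀ (hνpos y)]
    rwa [inv_mul_le_iff₀ hρ0] at hy

theorem summable_orbit {G X : Type*} [Group G] [MulAction G X] {S : Finset G} {x : X}
    (h : Tendsto (fun n : ℕ => (Nat.card (orbitSet S x n) : ℝ) ^ (1 / (n : ℝ))) atTop (nhds 1))
    {r : ℝ} (hr0 : 0 < r) (hr1 : r < 1) :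
    Summable (fun y : X => ∑' n, (orbitSet S x n).indicator (fun _ => r ^ n) y) := by
  have hs : Summable (fun n : ℕ => (Nat.card (orbitSet S x n) : ℝ) * r ^ n) := by
    obtain ⟨ρ, hρ, hρr⟩ := exists_between (one_lt_inv₀ hr0 |>.2 hr1)
    have hρ0 : 0 < ρ := by linarith
    have hlt : ρ * r < 1 := by
      have := mul_lt_mul_of_pos_right hρr hr0
      rwa [inv_mul_cancel₀ hr0.ne'] at this
    refine summable_of_isBigO_nat (summable_geometric_of_lt_one (by positivity) hlt) ?_
    refine Asymptotics.IsBigO.of_bound 1 ?_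
    filter_upwards [h.eventually (gt_mem_nhds hρ), eventually_gt_atTop 0] with n hn hn0
    rw [Real.norm_of_nonneg (by positivity), Real.norm_of_nonneg (by positivity), one_mul, mul_pow]
    refine mul_le_mul_of_nonneg_right ?_ (by positivity)
    have := pow_le_pow_left₀ (by positivity) hn.le n
    rwa [one_div, Real.rpow_inv_natCast_pow (by positivity) hn0.ne'] at this
  have hprod : Summable (fun p : ℕ × X => (orbitSet S x p.1).indicator (fun _ => r ^ p.1) p.2) := by
    rw [summable_prod_of_nonneg (fun p => Set.indicator_nonneg (fun _ _ => by positivity) _)]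
    have hsupp : ∀ n, ∀ y ∉ (orbitSet_finite S x n).toFinset,
        (orbitSet S x n).indicator (fun _ => r ^ n) y = 0 := fun n y hy =>
      Set.indicator_of_notMem (by simpa using hy) _
    refine ⟨fun n => summable_of_ne_finset_zero (hsupp n), ?_⟩
    refine hs.congr fun n => ?_
    simp only
    have hc : ∑ y ∈ (orbitSet_finite S x n).toFinset,
        (orbitSet S x n).indicator (fun _ => r ^ n) y =
        ∑ y ∈ (orbitSet_finite S x n).toFinset, r ^ n :=
      Finset.sum_congr rfl fun y hy =>
        Set.indicator_of_mem ((orbitSet_finite S x n).mem_toFinset.1 hy) _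
    rw [tsum_eq_sum (hsupp n), hc, Finset.sum_const, nsmul_eq_mul,
      Nat.card_coe_set_eq, Set.ncard_eq_toFinset_card _ (orbitSet_finite S x n)]
  exact hprod.prod_symm.prod

theorem exists_exhaustion (Y : Type*) [Countable Y] :
    ∃ A : ℕ → Finset Y, Monotone A ∧ ∀ y, ∃ k, y ∈ A k := by
  obtain ⟨f, hf⟩ := exists_injective_nat Y
  have hfin : ∀ k : ℕ, (f ⁻¹' Set.Iic k).Finite := fun k => (Set.finite_Iic k).preimage hf.injOn
  refine ⟨fun k => (hfin k).toFinset, fun i j hij y hy => ?_, fun y => ⟨f y, by simp⟩⟩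
  simp only [Set.Finite.mem_toFinset, Set.mem_preimage, Set.mem_Iic] at hy ⊢
  omega

theorem backward_dir {G X : Type*} [Group G] [MulAction G X] [Countable G] [Countable X]
    (h : ∀ (S : Finset G) (x : X),
        Tendsto (fun n : ℕ => (Nat.card (orbitSet S x n) : ℝ) ^ (1 / (n : ℝ)))
          atTop (nhds 1)) :
    ∃ ν : X → ℝ, Summable ν ∧ (∀ x, 0 < ν x) ∧
        ∀ g : G, Tendsto (fun x : X => ν (g • x) / ν x) cofinite (nhds 1) := by
  obtain ⟨S, hSm, hS⟩ := exists_exhaustion G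
  obtain ⟨A, hAm, hA⟩ := exists_exhaustion X
  set r : ℕ → ℝ := fun k => 1 - 1 / ((k : ℝ) + 2) with hr
  have hr0 : ∀ k, 0 < r k := fun k => by
    have : 1 / ((k : ℝ) + 2) < 1 := by
      rw [div_lt_one (by positivity)]
      have : (0 : ℝ) ≤ k := by positivity
      linarith
    simp only [hr]; linarith
  have hr1 : ∀ k, r k < 1 := fun k => by
    have : 0 < 1 / ((k : ℝ) + 2) := by positivity
    simp only [hr]; linarith
  have hrlt : ∀ k, r k < r (k + 1) := fun k => by
    have : 1 / (((k + 1 : ℕ) : ℝ) + 2) < 1 / ((k : ℝ) + 2) :=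
      one_div_lt_one_div_of_lt (by positivity) (by push_cast; linarith)
    simp only [hr]; linarith
  have hrt : Tendsto r atTop (nhds 1) := by
    have h1 : Tendsto (fun k : ℕ => 1 / ((k : ℝ) + 2)) atTop (nhds 0) := by
      have := (tendsto_const_nhds (x := (1 : ℝ))).div_atTop
        (tendsto_atTop_add_const_right atTop (2 : ℝ) tendsto_natCast_atTop_atTop)
      exact this
    simpa [hr] using h1.const_sub 1
  set I : ℕ → X → X → ℕ → ℝ := fun k a y n => (orbitSet (S k) a n).indicator (fun _ => r k ^ n) y with hI
  have hI0 : ∀ k a y n, 0 ≤ I k a y n := fun k a y n =>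
    Set.indicator_nonneg (fun _ _ => (pow_pos (hr0 k) n).le) _
  have hIs : ∀ k a y, Summable (I k a y) := fun k a y =>
    Summable.of_nonneg_of_le (hI0 k a y)
      (fun n => Set.indicator_le_self' (fun _ _ => (pow_pos (hr0 k) n).le) _)
      (summable_geometric_of_lt_one (hr0 k).le (hr1 k))
  have hu0 : ∀ k a y, 0 ≤ ∑' n, I k a y n := fun k a y => tsum_nonneg (hI0 k a y)
  refine abstract_back (fun k y => ∑ a ∈ A k, ∑' n, I k a y n) r ?_ ?_ ?_ hrt ?_ ?_
  · exact fun k y => Finset.sum_nonneg fun a _ => hu0 k a y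
  · exact fun k => summable_sum fun a _ => summable_orbit (h (S k) a) (hr0 k) (hr1 k)
  · intro y
    obtain ⟨k, hk⟩ := hA y
    refine ⟨k, Finset.sum_pos' (fun a _ => hu0 k a y) ⟨y, hk, ?_⟩⟩
    refine (hIs k y y).tsum_pos (hI0 k y y) 0 ?_
    simp [hI, self_mem_orbitSet]
  · intro g
    obtain ⟨K, hK⟩ := hS g
    filter_upwards [eventually_ge_atTop K] with k hk y
    have hgk : g ∈ S k := hSm hk hK
    rw [Finset.mul_sum]
    refine Finset.sum_le_sum fun a _ => ?_
    rw [← tsum_mul_left, (hIs k a (g • y)).tsum_eq_zero_add]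
    refine le_trans ?_ (le_add_of_nonneg_left (hI0 _ _ _ _))
    refine ((hIs k a y).mul_left _).tsum_le_tsum (fun n => ?_) ((summable_nat_add_iff 1).2 (hIs k a (g • y)))
    by_cases hy : y ∈ orbitSet (S k) a n
    · have := smul_mem_orbitSet hgk hy
      simp [hI, hy, this, pow_succ, mul_comm]
    · have := hI0 k a (g • y) (n + 1)
      simpa [hI, hy] using this
  · intro k δ hδ
    have hq1 : r k / r (k + 1) < 1 := (div_lt_one (hr0 _)).2 (hrlt k)
    have hq0 : 0 < r k / r (k + 1) := div_pos (hr0 _) (hr0 _)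
    obtain ⟨N, hN⟩ := exists_pow_lt_of_lt_one hδ hq1
    have hev : ∀ᶠ y in cofinite, ∀ a ∈ A k, y ∉ orbitSet (S k) a N := by
      rw [Filter.eventually_all_finset]
      intro a _
      exact (orbitSet_finite (S k) a N).eventually_cofinite_notMem
    filter_upwards [hev] with y hy
    rw [Finset.mul_sum]
    calc ∑ a ∈ A k, ∑' n, I k a y n ≤ ∑ a ∈ A k, δ * ∑' n, I (k + 1) a y n := by
          refine Finset.sum_le_sum fun a ha => ?_
          rw [← tsum_mul_left]
          refine (hIs k a y).tsum_le_tsum (fun n => ?_) ((hIs (k + 1) a y).mul_left _)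
          by_cases hyn : y ∈ orbitSet (S k) a n
          · have hNn : N ≤ n := by
              by_contra hcon
              exact hy a ha (orbitSet_mono subset_rfl (by omega) hyn)
            have hyn' : y ∈ orbitSet (S (k + 1)) a n :=
              orbitSet_mono (hSm (Nat.le_succ k)) le_rfl hyn
            simp only [hI, Set.indicator_of_mem hyn, Set.indicator_of_mem hyn']
            have h1 : (r k / r (k + 1)) ^ n ≤ δ :=
              (pow_le_pow_of_le_one hq0.le hq1.le hNn).trans hN.le
            rwa [div_pow, div_le_iff₀ (pow_pos (hr0 _) n)] at h1
          · have := mul_nonneg hδ.le (hI0 (k + 1) a y n)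
            simpa [hI, hyn] using this
      _ ≤ ∑ a ∈ A (k + 1), δ * ∑' n, I (k + 1) a y n :=
          Finset.sum_le_sum_of_subset_of_nonneg (hAm (Nat.le_succ k))
            fun a _ _ => mul_nonneg hδ.le (hu0 _ _ _)

theorem moderate_l1_iff_subexp_orbits
    {G X : Type*} [Group G] [MulAction G X] [Countable G] [Countable X] :
    (∃ ν : X → ℝ, Summable ν ∧ (∀ x, 0 < ν x) ∧
        ∀ g : G, Tendsto (fun x : X => ν (g • x) / ν x) cofinite (nhds 1)) ↔
      (∀ (S : Finset G) (x : X),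
        Tendsto (fun n : ℕ => (Nat.card (orbitSet S x n) : ℝ) ^ (1 / (n : ℝ)))
          atTop (nhds 1)) := by
  constructor
  · rintro ⟨ν, hs, hpos, hν⟩ S x
    exact forward_dir ν hs hpos hν S x
  · exact backward_dir
end
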